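/- arXiv:2511.17650 — 9 statements merged into one kernel-verified Lean document; each statement's English description precedes it below -/
import Mathlib

section
/- For every k ∈ ℕ: (1) Σ_{i=0}^{2^k−1} a(i,k) = (α+1)^k; (2) if α ≠ 3 then (α−3) · Σ_{i=0}^{2^k−1} b(i,k) = β · ((α+1)^k − 4^k) (an identity in ℤ), while if α = 3 then Σ_{i=0}^{2^k−1} b(i,k) = β · k · 4^{k−1}. -/
theorem affine_coeff_unique {p q p' q' i N : ℕ} (hN : 0 < N)
    (h : ∀ m, p * (i + N * m) + q = p' * (i + N * m) + q') : p = p' ∧ q = q' := by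
  have h0 := h 0
  have h1 := h 1
  have hp : p * N = p' * N := by
    simp only [mul_zero, mul_one, add_zero] at h0 h1
    linarith
  obtain rfl := Nat.eq_of_mul_eq_mul_right hN hp
  exact ⟨rfl, Nat.add_left_cancel h0⟩

theorem sum_range_affine_mod {α N : ℕ} (c : ℕ) (hN : 0 < N) (hα : N.Coprime α) (f : ℕ → ℕ) :
    ∑ i ∈ Finset.range N, f ((α * i + c) % N) = ∑ i ∈ Finset.range N, f i := by
  have hmaps : Set.MapsTo (fun i => (α * i + c) % N) (Finset.range N : Set ℕ)
      (Finset.range N : Set ℕ) := fun i _ => by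
    simpa using Nat.mod_lt _ hN
  have hinj : Set.InjOn (fun i => (α * i + c) % N) (Finset.range N : Set ℕ) := by
    intro i hi j hj hij
    have hmod : α * i ≡ α * j [MOD N] := Nat.ModEq.add_right_cancel' c hij
    have hmod' : i ≡ j [MOD N] := Nat.ModEq.cancel_left_of_coprime hα hmod
    exact hmod'.eq_of_lt_of_lt (by simpa using hi) (by simpa using hj)
  exact Finset.sum_nbij _ hmaps hinj
    (Finset.surjOn_of_injOn_of_card_le _ hmaps hinj le_rfl) fun _ _ => rfl

theorem sum_range_two_mul (f : ℕ → ℕ) (N : ℕ) :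
    ∑ i ∈ Finset.range (2 * N), f i =
      ∑ j ∈ Finset.range N, f (2 * j) + ∑ j ∈ Finset.range N, f (2 * j + 1) := by
  induction N with
  | zero => simp
  | succ N ih =>
    rw [show 2 * (N + 1) = 2 * N + 1 + 1 by ring]
    simp only [Finset.sum_range_succ, ih]
    ring

section Collatz

variable {α β : ℕ} {C : ℕ → ℕ} {a b : ℕ → ℕ → ℕ}

theorem collatz_coeff_zero
    (hab : ∀ k n : ℕ, 2 ^ k * C^[k] n = a (n % 2 ^ k) k * n + b (n % 2 ^ k) k) :
    a 0 0 = 1 ∧ b 0 0 = 0 := by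
  refine affine_coeff_unique (i := 0) one_pos fun m => ?_
  have h := hab 0 m
  simp only [pow_zero, Nat.mod_one, Function.iterate_zero, id] at h
  linarith

theorem collatz_coeff_even
    (hC : ∀ n : ℕ, C n = if n % 2 = 0 then n / 2 else (α * n + β) / 2)
    (hab : ∀ k n : ℕ, 2 ^ k * C^[k] n = a (n % 2 ^ k) k * n + b (n % 2 ^ k) k)
    {k j : ℕ} (hj : j < 2 ^ k) :
    a (2 * j) (k + 1) = a j k ∧ b (2 * j) (k + 1) = 2 * b j k := by
  refine affine_coeff_unique (i := 2 * j) (N := 2 ^ (k + 1)) (by positivity) fun m => ?_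
  have hstep : C (2 * j + 2 ^ (k + 1) * m) = j + 2 ^ k * m := by
    rw [hC, show 2 * j + 2 ^ (k + 1) * m = 2 * (j + 2 ^ k * m) by ring]
    simp
  have h := hab (k + 1) (2 * j + 2 ^ (k + 1) * m)
  have h' := hab k (j + 2 ^ k * m)
  rw [Function.iterate_succ_apply, hstep, Nat.add_mul_mod_self_left,
    Nat.mod_eq_of_lt (by rw [pow_succ]; omega)] at h
  rw [Nat.add_mul_mod_self_left, Nat.mod_eq_of_lt hj] at h'
  rw [← h, pow_succ, mul_right_comm, h']
  ring

theorem collatz_coeff_odd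
    (hC : ∀ n : ℕ, C n = if n % 2 = 0 then n / 2 else (α * n + β) / 2)
    (hab : ∀ k n : ℕ, 2 ^ k * C^[k] n = a (n % 2 ^ k) k * n + b (n % 2 ^ k) k)
    {c : ℕ} (hc : α + β = 2 * c) {k j : ℕ} (hj : j < 2 ^ k) :
    a (2 * j + 1) (k + 1) = α * a ((α * j + c) % 2 ^ k) k ∧
      b (2 * j + 1) (k + 1) =
        β * a ((α * j + c) % 2 ^ k) k + 2 * b ((α * j + c) % 2 ^ k) k := by
  refine affine_coeff_unique (i := 2 * j + 1) (N := 2 ^ (k + 1)) (by positivity) fun m => ?_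
  have hstep : C (2 * j + 1 + 2 ^ (k + 1) * m) = α * j + c + 2 ^ k * (α * m) := by
    rw [hC, show 2 * j + 1 + 2 ^ (k + 1) * m = 2 * (j + 2 ^ k * m) + 1 by ring,
      if_neg (by omega), show α * (2 * (j + 2 ^ k * m) + 1) + β =
        2 * (α * (j + 2 ^ k * m)) + (α + β) by ring, hc, ← mul_add,
      Nat.mul_div_cancel_left _ two_pos]
    ring
  have h := hab (k + 1) (2 * j + 1 + 2 ^ (k + 1) * m)
  have h' := hab k (α * j + c + 2 ^ k * (α * m))
  rw [Function.iterate_succ_apply, hstep, Nat.add_mul_mod_self_left,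
    Nat.mod_eq_of_lt (by rw [pow_succ]; omega)] at h
  rw [Nat.add_mul_mod_self_left] at h'
  rw [← h, pow_succ, mul_right_comm, h']
  linear_combination a ((α * j + c) % 2 ^ k) k * hc.symm

theorem sum_collatz_coeff_succ (hα : Odd α) (hβ : Odd β)
    (hC : ∀ n : ℕ, C n = if n % 2 = 0 then n / 2 else (α * n + β) / 2)
    (hab : ∀ k n : ℕ, 2 ^ k * C^[k] n = a (n % 2 ^ k) k * n + b (n % 2 ^ k) k) (k : ℕ) :
    ∑ i ∈ Finset.range (2 ^ (k + 1)), a i (k + 1) =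
        (α + 1) * ∑ i ∈ Finset.range (2 ^ k), a i k ∧
      ∑ i ∈ Finset.range (2 ^ (k + 1)), b i (k + 1) =
        4 * ∑ i ∈ Finset.range (2 ^ k), b i k + β * ∑ i ∈ Finset.range (2 ^ k), a i k := by
  obtain ⟨c, hc⟩ := (hα.add_odd hβ).two_dvd
  have hperm := sum_range_affine_mod c (Nat.two_pow_pos k) (hα.coprime_two_left.pow_left k)
  have heven := fun j (hj : j ∈ Finset.range (2 ^ k)) =>
    collatz_coeff_even hC hab (Finset.mem_range.mp hj)
  have hodd := fun j (hj : j ∈ Finset.range (2 ^ k)) =>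
    collatz_coeff_odd hC hab hc (Finset.mem_range.mp hj)
  rw [pow_succ', sum_range_two_mul, sum_range_two_mul,
    Finset.sum_congr rfl fun j hj => (heven j hj).1, Finset.sum_congr rfl fun j hj => (hodd j hj).1,
    Finset.sum_congr rfl fun j hj => (heven j hj).2, Finset.sum_congr rfl fun j hj => (hodd j hj).2,
    Finset.sum_add_distrib]
  simp only [← Finset.mul_sum]
  rw [hperm (a · k), hperm (b · k)]
  constructor <;> ring

end Collatz

/-- sums of the coefficients in the affine decomposition of C^k. -/
theorem collatz_coefficient_sums
    (α β : ℕ) (hα : Odd α) (hα0 : 0 < α) (hβ : Odd β) (hβ0 : 0 < β)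
    (hgcd : Nat.gcd α β = 1) (C : ℕ → ℕ)
    (hC : ∀ n : ℕ, C n = if n % 2 = 0 then n / 2 else (α * n + β) / 2)
    (a b : ℕ → ℕ → ℕ)
    (hab : ∀ k n : ℕ, 2 ^ k * C^[k] n = a (n % 2 ^ k) k * n + b (n % 2 ^ k) k)
    (k : ℕ) :
    (∑ i ∈ Finset.range (2 ^ k), a i k = (α + 1) ^ k) ∧
    (α ≠ 3 → ((α : ℤ) - 3) * ∑ i ∈ Finset.range (2 ^ k), (b i k : ℤ)
        = (β : ℤ) * (((α : ℤ) + 1) ^ k - 4 ^ k)) ∧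
    (α = 3 → ∑ i ∈ Finset.range (2 ^ k), b i k = β * k * 4 ^ (k - 1)) := by
  have hsum : ∀ k, ∑ i ∈ Finset.range (2 ^ k), a i k = (α + 1) ^ k := fun k => by
    induction k with
    | zero => simp [(collatz_coeff_zero hab).1]
    | succ k ih => rw [(sum_collatz_coeff_succ hα hβ hC hab k).1, ih, pow_succ']
  have hrec : ∀ k, ∑ i ∈ Finset.range (2 ^ (k + 1)), b i (k + 1) =
      4 * ∑ i ∈ Finset.range (2 ^ k), b i k + β * (α + 1) ^ k := fun k => by
    rw [(sum_collatz_coeff_succ hα hβ hC hab k).2, hsum]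
  refine ⟨hsum k, fun _ => ?_, ?_⟩
  · induction k with
    | zero => simp [(collatz_coeff_zero hab).2]
    | succ k ih =>
      have h : (∑ i ∈ Finset.range (2 ^ (k + 1)), (b i (k + 1) : ℤ)) =
          4 * ∑ i ∈ Finset.range (2 ^ k), (b i k : ℤ) + β * (α + 1) ^ k := mod_cast hrec k
      rw [h]
      linear_combination 4 * ih
  · rintro rfl
    induction k with
    | zero => simp [(collatz_coeff_zero hab).2]
    | succ k ih =>
      rw [hrec, ih]
      cases k with
      | zero => simp
      | succ k =>
        simp only [Nat.add_sub_cancel]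
        ring
end

section
/- (Energy conservation.) For every k ∈ ℕ and every n ∈ ℕ, Σ_{j=0}^{2^k−1} C^k(n + j + 2^k) = Σ_{j=0}^{2^k−1} C^k(n + j) + (1+α)^k; equivalently, the sum Σ_{j=0}^{2^k−1} ( C^k(n+j+2^k) − C^k(n+j) ) equals (1+α)^k independently of n. -/
theorem Finset.sum_range_two_mul_eq_even_add_odd {M : Type*} [AddCommMonoid M] (f : ℕ → M)
    (m : ℕ) :
    ∑ j ∈ Finset.range (2 * m), f j =
      ∑ i ∈ Finset.range m, f (2 * i) + ∑ i ∈ Finset.range m, f (2 * i + 1) := by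
  induction m with
  | zero => simp
  | succ m ih =>
    rw [Nat.mul_succ, Finset.sum_range_succ, Finset.sum_range_succ, ih,
      Finset.sum_range_succ, Finset.sum_range_succ]
    abel

/-- Energy conservation along an arithmetic progression with odd common difference `a`. -/
theorem sum_iterate_add_two_pow_mul {C : ℕ → ℕ} {α γ : ℕ} (hα : Odd α)
    (h_even : ∀ x, C (2 * x) = x) (h_odd : ∀ x, C (2 * x + 1) = α * x + γ)
    (k a b t : ℕ) (ha : Odd a) :
    ∑ j ∈ Finset.range (2 ^ k), C^[k] (a * j + b + 2 ^ k * t) =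
      ∑ j ∈ Finset.range (2 ^ k), C^[k] (a * j + b) + t * (1 + α) ^ k := by
  induction k generalizing a b t with
  | zero => simp
  | succ k ih =>
    rw [pow_succ' 2 k, Finset.sum_range_two_mul_eq_even_add_odd,
      Finset.sum_range_two_mul_eq_even_add_odd]
    simp only [Function.iterate_succ_apply]
    obtain ⟨a', ha'⟩ := id ha
    have even_step (c i s : ℕ) : C (2 * (a * i + c + 2 ^ k * s)) = a * i + c + 2 ^ k * s :=
      h_even _
    have odd_step (c i s : ℕ) : C (2 * (a * i + c + 2 ^ k * s) + 1) =
        α * a * i + (α * c + γ) + 2 ^ k * (α * s) := by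
      rw [h_odd]; ring
    have even_sum (c : ℕ) := ih a c t ha
    have odd_sum (c : ℕ) := ih (α * a) (α * c + γ) (α * t) (hα.mul ha)
    rcases Nat.even_or_odd' b with ⟨c, rfl | rfl⟩
    · have h₁ (i s : ℕ) : C (a * (2 * i) + 2 * c + 2 * 2 ^ k * s) = _ :=
        (congrArg C (by ring)).trans (even_step c i s)
      have h₂ (i s : ℕ) : C (a * (2 * i + 1) + 2 * c + 2 * 2 ^ k * s) = _ :=
        (congrArg C (by rw [mul_add a, mul_one]; nth_rw 2 [ha']; ring)).trans
          (odd_step (a' + c) i s)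
      have h₁' (i : ℕ) := h₁ i 0
      have h₂' (i : ℕ) := h₂ i 0
      simp only [mul_zero, add_zero] at h₁' h₂'
      simp only [h₁, h₂, h₁', h₂', even_sum, odd_sum]
      ring
    · have h₁ (i s : ℕ) : C (a * (2 * i) + (2 * c + 1) + 2 * 2 ^ k * s) = _ :=
        (congrArg C (by ring)).trans (odd_step c i s)
      have h₂ (i s : ℕ) : C (a * (2 * i + 1) + (2 * c + 1) + 2 * 2 ^ k * s) = _ :=
        (congrArg C (by rw [mul_add a, mul_one]; nth_rw 2 [ha']; ring)).trans
          (even_step (a' + c + 1) i s)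
      have h₁' (i : ℕ) := h₁ i 0
      have h₂' (i : ℕ) := h₂ i 0
      simp only [mul_zero, add_zero] at h₁' h₂'
      simp only [h₁, h₂, h₁', h₂', even_sum, odd_sum]
      ring


/-- energy conservation:
Σ_{j<2^k} C^k(n+j+2^k) = Σ_{j<2^k} C^k(n+j) + (1+α)^k. -/
theorem collatz_energy_conservation
    (α β : ℕ) (hα : Odd α) (hα0 : 0 < α) (hβ : Odd β) (hβ0 : 0 < β)
    (hgcd : Nat.gcd α β = 1) (C : ℕ → ℕ)
    (hC : ∀ n : ℕ, C n = if n % 2 = 0 then n / 2 else (α * n + β) / 2)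
    (k n : ℕ) :
    ∑ j ∈ Finset.range (2 ^ k), C^[k] (n + j + 2 ^ k)
      = ∑ j ∈ Finset.range (2 ^ k), C^[k] (n + j) + (1 + α) ^ k := by
  obtain ⟨γ, hγ⟩ := hα.add_odd hβ
  have h_even (x : ℕ) : C (2 * x) = x := by
    rw [hC, if_pos (by omega)]
    omega
  have h_odd (x : ℕ) : C (2 * x + 1) = α * x + γ := by
    rw [hC, if_neg (by omega), show α * (2 * x + 1) + β = 2 * (α * x + γ) by linarith]
    omega
  simpa [add_comm] using sum_iterate_add_two_pow_mul hα h_even h_odd k 1 n 1 odd_one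
end

section
/- For all n, k, m ∈ ℕ one has s_{k,m}(n) = s_k(n) + m·(1+α)^k. -/
/-- The product of the multipliers (`1` at even terms, `α` at odd terms) along the first `k` terms
of the orbit of `n` under `C`. -/
def orbitMultiplier (α : ℕ) (C : ℕ → ℕ) (k n : ℕ) : ℕ :=
  ∏ i ∈ Finset.range k, if C^[i] n % 2 = 0 then 1 else α

theorem orbitMultiplier_succ (α : ℕ) (C : ℕ → ℕ) (k n : ℕ) :
    orbitMultiplier α C (k + 1) n =
      orbitMultiplier α C k n * if C^[k] n % 2 = 0 then 1 else α :=
  Finset.prod_range_succ _ _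

theorem odd_orbitMultiplier {α : ℕ} (hα : Odd α) (C : ℕ → ℕ) (k n : ℕ) :
    Odd (orbitMultiplier α C k n) := by
  induction k with
  | zero => simp [orbitMultiplier]
  | succ k ih =>
    rw [orbitMultiplier_succ]
    split_ifs
    · simpa using ih
    · exact ih.mul hα

theorem collatz_add_two_mul {α β : ℕ} {C : ℕ → ℕ}
    (hC : ∀ n : ℕ, C n = if n % 2 = 0 then n / 2 else (α * n + β) / 2)
    (x d : ℕ) :
    C (x + 2 * d) = C x + d * if x % 2 = 0 then 1 else α := by
  rw [hC, hC x, Nat.add_mul_mod_self_left]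
  split_ifs
  · omega
  · rw [show α * (x + 2 * d) + β = α * x + β + 2 * (d * α) by ring]
    omega

theorem collatz_iterate_add_mul_two_pow {α β : ℕ} {C : ℕ → ℕ}
    (hC : ∀ n : ℕ, C n = if n % 2 = 0 then n / 2 else (α * n + β) / 2)
    (k n m : ℕ) :
    C^[k] (n + m * 2 ^ k) = C^[k] n + m * orbitMultiplier α C k n ∧
      orbitMultiplier α C k (n + m * 2 ^ k) = orbitMultiplier α C k n := by
  induction k generalizing m with
  | zero => simp [orbitMultiplier]
  | succ k ih =>
    obtain ⟨hiter, hmult⟩ := ih (2 * m)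
    rw [show m * 2 ^ (k + 1) = 2 * m * 2 ^ k by ring]
    simp only [Function.iterate_succ_apply', orbitMultiplier_succ, hiter, hmult]
    simp only [mul_assoc, collatz_add_two_mul hC, Nat.add_mul_mod_self_left, and_self]

theorem sum_orbitMultiplier {α β : ℕ} {C : ℕ → ℕ}
    (hC : ∀ n : ℕ, C n = if n % 2 = 0 then n / 2 else (α * n + β) / 2)
    (hα : Odd α) (k n : ℕ) :
    ∑ j ∈ Finset.range (2 ^ k), orbitMultiplier α C k (n + j) = (1 + α) ^ k := by
  induction k with
  | zero => simp [orbitMultiplier]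
  | succ k ih =>
    rw [pow_succ 2 k, mul_two, Finset.sum_range_add, ← Finset.sum_add_distrib, pow_succ, ← ih,
      Finset.sum_mul]
    refine Finset.sum_congr rfl fun j _ => ?_
    obtain ⟨hiter, hmult⟩ := collatz_iterate_add_mul_two_pow hC k (n + j) 1
    have hodd := Nat.odd_iff.mp (odd_orbitMultiplier hα C k (n + j))
    rw [one_mul] at hiter hmult
    rw [show n + (2 ^ k + j) = n + j + 2 ^ k by ring, orbitMultiplier_succ, orbitMultiplier_succ,
      hmult, hiter, ← mul_add]
    congr 1
    split_ifs <;> omega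

/-- s_{k,m}(n) = s_k(n) + m·(1+α)^k. -/
theorem collatz_shifted_sum_formula
    (α β : ℕ) (hα : Odd α) (hα0 : 0 < α) (hβ : Odd β) (hβ0 : 0 < β)
    (hgcd : Nat.gcd α β = 1) (C : ℕ → ℕ)
    (hC : ∀ n : ℕ, C n = if n % 2 = 0 then n / 2 else (α * n + β) / 2)
    (n k m : ℕ) :
    ∑ j ∈ Finset.range (2 ^ k), C^[k] (n + j + m * 2 ^ k)
      = ∑ j ∈ Finset.range (2 ^ k), C^[k] (n + j) + m * (1 + α) ^ k := by
  rw [← sum_orbitMultiplier hC hα k n, Finset.mul_sum, ← Finset.sum_add_distrib]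
  exact Finset.sum_congr rfl fun j _ => (collatz_iterate_add_mul_two_pow hC k (n + j) m).1
end

section
/- For every fixed k, m ∈ ℕ, the ratio s_{k,m}(n)/s_k(n) tends to 1 as n → ∞; that is, the sequence n ↦ (s_{k,m}(n) : ℝ)/(s_k(n) : ℝ) converges to 1 along the filter atTop. -/
/-- Shifting the argument of the `k`-th iterate of a generalized Collatz map by a multiple of `2 ^ k`
increases its value by a bounded amount. -/
theorem collatz_iterate_add {α β : ℕ} (hα0 : 0 < α) {C : ℕ → ℕ}
    (hC : ∀ n : ℕ, C n = if n % 2 = 0 then n / 2 else (α * n + β) / 2) (k n q : ℕ) :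
    ∃ d ≤ α ^ k * q, C^[k] (n + q * 2 ^ k) = C^[k] n + d := by
  induction k generalizing n q with
  | zero => exact ⟨q, by simp, by simp⟩
  | succ k ih =>
    obtain ⟨p, hp, hCp⟩ : ∃ p ≤ α * q, C (n + q * 2 ^ (k + 1)) = C n + p * 2 ^ k := by
      have hpow : n + q * 2 ^ (k + 1) = n + 2 * (q * 2 ^ k) := by ring
      have hmod : (n + 2 * (q * 2 ^ k)) % 2 = n % 2 := by omega
      rw [hpow, hC, hC n, hmod]
      split_ifs
      · exact ⟨q, Nat.le_mul_of_pos_left q hα0, by omega⟩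
      · refine ⟨α * q, le_rfl, ?_⟩
        have hmul : α * (n + 2 * (q * 2 ^ k)) + β = α * n + β + 2 * (α * q * 2 ^ k) := by ring
        omega
    obtain ⟨d, hd, hCd⟩ := ih (C n) p
    refine ⟨d, hd.trans ?_, ?_⟩
    · calc α ^ k * p ≤ α ^ k * (α * q) := Nat.mul_le_mul_left _ hp
        _ = α ^ (k + 1) * q := by ring
    · rw [Function.iterate_succ_apply, Function.iterate_succ_apply, hCp, hCd]

/-- A generalized Collatz map at most halves its argument, so its `k`-th iterate divides it by at
most `2 ^ k`. -/
theorem le_two_pow_mul_collatz_iterate {α β : ℕ} (hα0 : 0 < α) (hβ0 : 0 < β) {C : ℕ → ℕ}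
    (hC : ∀ n : ℕ, C n = if n % 2 = 0 then n / 2 else (α * n + β) / 2) (k n : ℕ) :
    n ≤ 2 ^ k * C^[k] n := by
  induction k generalizing n with
  | zero => simp
  | succ k ih =>
    have hstep : n ≤ 2 * C n := by
      have hmul : n ≤ α * n := Nat.le_mul_of_pos_left n hα0
      rw [hC]
      split_ifs <;> omega
    rw [Function.iterate_succ_apply, pow_succ]
    linarith [ih (C n)]

/-- for fixed k, m, the ratio s_{k,m}(n)/s_k(n) tends to 1 as n → ∞. -/
theorem collatz_ratio_tendsto_one
    (α β : ℕ) (hα : Odd α) (hα0 : 0 < α) (hβ : Odd β) (hβ0 : 0 < β)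
    (hgcd : Nat.gcd α β = 1) (C : ℕ → ℕ)
    (hC : ∀ n : ℕ, C n = if n % 2 = 0 then n / 2 else (α * n + β) / 2)
    (k m : ℕ) :
    Filter.Tendsto
      (fun n : ℕ =>
        ((∑ j ∈ Finset.range (2 ^ k), C^[k] (n + j + m * 2 ^ k) : ℕ) : ℝ)
          / ((∑ j ∈ Finset.range (2 ^ k), C^[k] (n + j) : ℕ) : ℝ))
      Filter.atTop (nhds 1) := by
  have hlow (n : ℕ) : n ≤ ∑ j ∈ Finset.range (2 ^ k), C^[k] (n + j) := by
    refine Nat.le_of_mul_le_mul_left (c := 2 ^ k) ?_ (by positivity)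
    rw [Finset.mul_sum]
    calc 2 ^ k * n = ∑ _j ∈ Finset.range (2 ^ k), n := by simp
      _ ≤ _ := Finset.sum_le_sum fun j _ =>
        (Nat.le_add_right n j).trans (le_two_pow_mul_collatz_iterate hα0 hβ0 hC k (n + j))
  have hmono (n : ℕ) : ∑ j ∈ Finset.range (2 ^ k), C^[k] (n + j) ≤
      ∑ j ∈ Finset.range (2 ^ k), C^[k] (n + j + m * 2 ^ k) := by
    refine Finset.sum_le_sum fun j _ => ?_
    obtain ⟨d, -, h⟩ := collatz_iterate_add hα0 hC k (n + j) m
    omega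
  have hupp (n : ℕ) : ∑ j ∈ Finset.range (2 ^ k), C^[k] (n + j + m * 2 ^ k) ≤
      ∑ j ∈ Finset.range (2 ^ k), C^[k] (n + j) + 2 ^ k * (α ^ k * m) := by
    calc _ ≤ ∑ j ∈ Finset.range (2 ^ k), (C^[k] (n + j) + α ^ k * m) := by
          refine Finset.sum_le_sum fun j _ => ?_
          obtain ⟨d, hd, h⟩ := collatz_iterate_add hα0 hC k (n + j) m
          omega
      _ = _ := by simp [Finset.sum_add_distrib]
  have hlim : Filter.Tendsto (fun n : ℕ => 1 + ((2 ^ k * (α ^ k * m) : ℕ) : ℝ) / (n : ℝ))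
      Filter.atTop (nhds 1) := by
    simpa using (tendsto_const_div_atTop_nhds_zero_nat
      ((2 ^ k * (α ^ k * m) : ℕ) : ℝ)).const_add 1
  refine tendsto_of_tendsto_of_tendsto_of_le_of_le' tendsto_const_nhds hlim ?_ ?_
  all_goals
    filter_upwards [Filter.eventually_gt_atTop 0] with n hn
    have hn' : (0 : ℝ) < n := Nat.cast_pos.mpr hn
    have hs : (n : ℝ) ≤ ((∑ j ∈ Finset.range (2 ^ k), C^[k] (n + j) : ℕ) : ℝ) :=
      Nat.cast_le.mpr (hlow n)
  · rw [one_le_div (hn'.trans_le hs)]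
    exact Nat.cast_le.mpr (hmono n)
  · calc _ ≤ (((∑ j ∈ Finset.range (2 ^ k), C^[k] (n + j) : ℕ) : ℝ)
            + ((2 ^ k * (α ^ k * m) : ℕ) : ℝ)) /
            ((∑ j ∈ Finset.range (2 ^ k), C^[k] (n + j) : ℕ) : ℝ) := by
          gcongr
          exact_mod_cast hupp n
      _ = 1 + ((2 ^ k * (α ^ k * m) : ℕ) : ℝ) /
            ((∑ j ∈ Finset.range (2 ^ k), C^[k] (n + j) : ℕ) : ℝ) := by
          rw [add_div, div_self (hn'.trans_le hs).ne']
      _ ≤ _ := by gcongr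
end

section
/- Assume α = 1. Then for every n ≥ 1 and every m ∈ ℕ, the real sequence k ↦ s_{k,m}(n)/s_k(n) satisfies 1 + 2m/(1+2β) ≤ liminf_{k→∞} s_{k,m}(n)/s_k(n) ≤ limsup_{k→∞} s_{k,m}(n)/s_k(n) ≤ 1 + 2m. -/
/-- For multiplier `1`, translating the start by `m * 2 ^ k` translates the `k`-th iterate by `m`. -/
theorem iterate_add_mul_two_pow {β : ℕ} {C : ℕ → ℕ}
    (hC : ∀ n, C n = if n % 2 = 0 then n / 2 else (n + β) / 2) (m k N : ℕ) :
    C^[k] (N + m * 2 ^ k) = C^[k] N + m := by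
  induction k generalizing N with
  | zero => simp
  | succ k ih =>
    have hstep : C (N + m * 2 ^ (k + 1)) = C N + m * 2 ^ k := by
      rw [hC, hC, pow_succ, ← mul_assoc]
      split_ifs <;> omega
    rw [Function.iterate_succ_apply, Function.iterate_succ_apply, hstep, ih]

theorem le_two_pow_mul_iterate {β : ℕ} {C : ℕ → ℕ} (hβ : Odd β)
    (hC : ∀ n, C n = if n % 2 = 0 then n / 2 else (n + β) / 2) (k N : ℕ) :
    N ≤ 2 ^ k * C^[k] N := by
  induction k generalizing N with
  | zero => simp
  | succ k ih =>
    have hstep : N ≤ 2 * C N := by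
      obtain ⟨b, rfl⟩ := hβ
      rw [hC]
      split_ifs <;> omega
    rw [Function.iterate_succ_apply, pow_succ]
    linarith [ih (C N)]

theorem two_pow_mul_iterate_add_le {β : ℕ} {C : ℕ → ℕ}
    (hC : ∀ n, C n = if n % 2 = 0 then n / 2 else (n + β) / 2) (k N : ℕ) :
    2 ^ k * C^[k] N + β ≤ N + β * 2 ^ k := by
  induction k generalizing N with
  | zero => simp
  | succ k ih =>
    have hstep : 2 * C N ≤ N + β := by
      rw [hC]
      split_ifs <;> omega
    rw [Function.iterate_succ_apply, pow_succ]
    linarith [ih (C N)]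

theorem two_mul_sum_range_add (n M : ℕ) :
    2 * ∑ j ∈ Finset.range M, (n + j) + M = M * (2 * n + M) := by
  induction M with
  | zero => simp
  | succ M ih =>
    rw [Finset.sum_range_succ]
    linarith

theorem two_pow_le_two_mul_sum_iterate {β : ℕ} {C : ℕ → ℕ} (hβ : Odd β)
    (hC : ∀ n, C n = if n % 2 = 0 then n / 2 else (n + β) / 2) {n : ℕ} (hn : 1 ≤ n) (k : ℕ) :
    2 ^ k ≤ 2 * ∑ j ∈ Finset.range (2 ^ k), C^[k] (n + j) := by
  have hpos : 0 < 2 ^ k := by positivity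
  have hsum := Finset.sum_le_sum fun j (_ : j ∈ Finset.range (2 ^ k)) =>
    le_two_pow_mul_iterate hβ hC k (n + j)
  rw [← Finset.mul_sum] at hsum
  have hgauss := two_mul_sum_range_add n (2 ^ k)
  refine Nat.le_of_mul_le_mul_left ?_ hpos
  nlinarith [Nat.mul_le_mul_left (2 ^ k) hn]

theorem two_mul_sum_iterate_le {β : ℕ} {C : ℕ → ℕ}
    (hC : ∀ n, C n = if n % 2 = 0 then n / 2 else (n + β) / 2) (n k : ℕ) :
    2 * ∑ j ∈ Finset.range (2 ^ k), C^[k] (n + j) ≤ (1 + 2 * β) * 2 ^ k + 2 * n := by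
  have hpos : 0 < 2 ^ k := by positivity
  have hsum := Finset.sum_le_sum fun j (_ : j ∈ Finset.range (2 ^ k)) =>
    (Nat.le_add_right _ β).trans (two_pow_mul_iterate_add_le hC k (n + j))
  rw [← Finset.mul_sum, Finset.sum_add_distrib, Finset.sum_const, Finset.card_range,
    smul_eq_mul] at hsum
  have hgauss := two_mul_sum_range_add n (2 ^ k)
  refine Nat.le_of_mul_le_mul_left ?_ hpos
  nlinarith


/-- for α = 1, bounds on liminf/limsup of s_{k,m}(n)/s_k(n) as k → ∞. -/
theorem collatz_ratio_liminf_limsup_alpha_one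
    (α β : ℕ) (hα : Odd α) (hα0 : 0 < α) (hβ : Odd β) (hβ0 : 0 < β)
    (hgcd : Nat.gcd α β = 1) (C : ℕ → ℕ)
    (hC : ∀ n : ℕ, C n = if n % 2 = 0 then n / 2 else (α * n + β) / 2)
    (hα1 : α = 1) (n : ℕ) (hn : 1 ≤ n) (m : ℕ) :
    1 + 2 * (m : ℝ) / (1 + 2 * (β : ℝ)) ≤
      Filter.liminf (fun k : ℕ =>
        ((∑ j ∈ Finset.range (2 ^ k), C^[k] (n + j + m * 2 ^ k) : ℕ) : ℝ)
          / ((∑ j ∈ Finset.range (2 ^ k), C^[k] (n + j) : ℕ) : ℝ)) Filter.atTop ∧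
    Filter.liminf (fun k : ℕ =>
        ((∑ j ∈ Finset.range (2 ^ k), C^[k] (n + j + m * 2 ^ k) : ℕ) : ℝ)
          / ((∑ j ∈ Finset.range (2 ^ k), C^[k] (n + j) : ℕ) : ℝ)) Filter.atTop ≤
      Filter.limsup (fun k : ℕ =>
        ((∑ j ∈ Finset.range (2 ^ k), C^[k] (n + j + m * 2 ^ k) : ℕ) : ℝ)
          / ((∑ j ∈ Finset.range (2 ^ k), C^[k] (n + j) : ℕ) : ℝ)) Filter.atTop ∧
    Filter.limsup (fun k : ℕ =>
        ((∑ j ∈ Finset.range (2 ^ k), C^[k] (n + j + m * 2 ^ k) : ℕ) : ℝ)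
          / ((∑ j ∈ Finset.range (2 ^ k), C^[k] (n + j) : ℕ) : ℝ)) Filter.atTop ≤
      1 + 2 * (m : ℝ) := by
  subst hα1
  simp only [one_mul] at hC
  set S : ℕ → ℕ := fun k => ∑ j ∈ Finset.range (2 ^ k), C^[k] (n + j)
  have hlow (k : ℕ) : (2 : ℝ) ^ k ≤ 2 * S k := by
    exact_mod_cast two_pow_le_two_mul_sum_iterate hβ hC hn k
  have hupp (k : ℕ) : 2 * (S k : ℝ) ≤ (1 + 2 * β) * 2 ^ k + 2 * n := by
    exact_mod_cast two_mul_sum_iterate_le hC n k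
  have hSpos (k : ℕ) : 0 < (S k : ℝ) := by
    have : (0 : ℝ) < 2 ^ k := by positivity
    linarith [hlow k]
  have hratio : (fun k : ℕ =>
      ((∑ j ∈ Finset.range (2 ^ k), C^[k] (n + j + m * 2 ^ k) : ℕ) : ℝ)
        / ((∑ j ∈ Finset.range (2 ^ k), C^[k] (n + j) : ℕ) : ℝ))
      = fun k => 1 + m * 2 ^ k / (S k : ℝ) := by
    funext k
    simp only [iterate_add_mul_two_pow hC, Finset.sum_add_distrib, Finset.sum_const,
      Finset.card_range, smul_eq_mul]
    change ((S k + 2 ^ k * m : ℕ) : ℝ) / S k = _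
    have := (hSpos k).ne'
    push_cast
    field_simp
  rw [hratio]
  have hle (k : ℕ) : 1 + m * 2 ^ k / (S k : ℝ) ≤ 1 + 2 * m := by
    have : m * 2 ^ k / (S k : ℝ) ≤ 2 * m := by
      rw [div_le_iff₀ (hSpos k)]
      nlinarith [mul_le_mul_of_nonneg_left (hlow k) (Nat.cast_nonneg (α := ℝ) m)]
    linarith
  have hge (k : ℕ) : 1 + 2 * (m : ℝ) / (1 + 2 * β + 2 * n * (1 / 2) ^ k)
      ≤ 1 + m * 2 ^ k / (S k : ℝ) := by
    gcongr 1 + ?_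
    rw [div_le_div_iff₀ (by positivity) (hSpos k)]
    calc 2 * (m : ℝ) * S k = m * (2 * S k) := by ring
      _ ≤ m * ((1 + 2 * β) * 2 ^ k + 2 * n) := by gcongr; exact hupp k
      _ = m * 2 ^ k * (1 + 2 * β + 2 * n * (1 / 2) ^ k) := by
        rw [one_div, inv_pow]
        field_simp
  have hlim : Filter.Tendsto
      (fun k : ℕ => 1 + 2 * (m : ℝ) / (1 + 2 * β + 2 * n * (1 / 2) ^ k)) Filter.atTop
      (nhds (1 + 2 * (m : ℝ) / (1 + 2 * β))) := by
    have hgeom := tendsto_pow_atTop_nhds_zero_of_lt_one (r := (1 / 2 : ℝ))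
      (by norm_num) (by norm_num)
    have hden := (hgeom.const_mul (2 * (n : ℝ))).const_add (1 + 2 * (β : ℝ))
    rw [mul_zero, add_zero] at hden
    exact (tendsto_const_nhds.div hden (by positivity)).const_add 1
  have hbddA : Filter.IsBoundedUnder (· ≤ ·) Filter.atTop
      fun k => 1 + m * 2 ^ k / (S k : ℝ) := Filter.isBoundedUnder_of ⟨_, hle⟩
  have hbddB : Filter.IsBoundedUnder (· ≥ ·) Filter.atTop
      fun k => 1 + m * 2 ^ k / (S k : ℝ) :=
    Filter.isBoundedUnder_of ⟨1, fun k => le_add_of_nonneg_right (by positivity)⟩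
  refine ⟨?_, Filter.liminf_le_limsup hbddA hbddB, ?_⟩
  · rw [← hlim.liminf_eq]
    exact Filter.liminf_le_liminf (Filter.Eventually.of_forall hge)
      hlim.isBoundedUnder_ge hbddA.isCoboundedUnder_ge
  · exact Filter.limsup_le_of_le hbddB.isCoboundedUnder_le (Filter.Eventually.of_forall hle)
end

section
/- For every m ≥ 1 the following two identities hold in ℤ: Σ_{i=0}^{2^m−1} Σ_{j=0}^{m} binom(m,j)·(−2)^j·a(i mod 2^{m−j}, m−j) = (α−3)^m, and Σ_{i=0}^{2^m−1} Σ_{j=0}^{m} binom(m,j)·(−2)^j·b(i mod 2^{m−j}, m−j) = β·(α−3)^{m−1}. (These are, respectively, the sum over all residue classes modulo 2^m of the coefficients of C^k(n) and of the free coefficients in the affine decomposition of the m-th discrete time derivative D_t^m(C^k(n)) = Σ_{j=0}^m binom(m,j)(−1)^j C^{m−j}(C^k(n)).) -/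
/-- Pascal's rule for binomial sums: the `m + 1`-st power of the operator `E - c`, with `E` the
shift, applied to `s` at `0` is the `m`-th power applied to `(E - c) s`. -/
theorem sum_choose_succ_mul_shift {R : Type*} [CommRing R] (c : R) (s : ℕ → R) (m : ℕ) :
    ∑ j ∈ Finset.range (m + 2), ((m + 1).choose j : R) * (-c) ^ j * s (m + 1 - j) =
      ∑ j ∈ Finset.range (m + 1),
        (m.choose j : R) * (-c) ^ j * (s (m - j + 1) - c * s (m - j)) := by
  have hfirst : ∑ j ∈ Finset.range (m + 1), (m.choose j : R) * (-c) ^ j * s (m - j + 1) =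
      ∑ j ∈ Finset.range (m + 2), (m.choose j : R) * (-c) ^ j * s (m + 1 - j) := by
    rw [Finset.sum_range_succ _ (m + 1)]
    simp only [Nat.choose_succ_self, Nat.cast_zero, zero_mul, add_zero]
    refine Finset.sum_congr rfl fun j hj => ?_
    rw [Finset.mem_range] at hj
    rw [show m - j + 1 = m + 1 - j by omega]
  simp only [mul_sub, Finset.sum_sub_distrib, hfirst]
  rw [Finset.sum_range_succ', Finset.sum_range_succ' _ (m + 1)]
  simp only [Nat.choose_succ_succ, Nat.cast_add, add_mul, Finset.sum_add_distrib,
    Nat.add_sub_add_right, pow_succ, Nat.choose_zero_right]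
  have hneg : ∑ j ∈ Finset.range (m + 1), (m.choose j : R) * ((-c) ^ j * -c) * s (m - j) =
      -∑ j ∈ Finset.range (m + 1), (m.choose j : R) * (-c) ^ j * (c * s (m - j)) := by
    rw [← Finset.sum_neg_distrib]
    exact Finset.sum_congr rfl fun j _ => by ring
  rw [hneg]
  ring

theorem sum_range_two_pow_succ {M : Type*} [AddCommMonoid M] (f : ℕ → M) (k : ℕ) :
    ∑ i ∈ Finset.range (2 ^ (k + 1)), f i =
      ∑ i ∈ Finset.range (2 ^ k), (f i + f (i + 2 ^ k)) := by
  rw [pow_succ, mul_two, Finset.sum_range_add, Finset.sum_add_distrib]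
  simp only [add_comm]

theorem sum_range_two_pow_mod {R : Type*} [CommRing R] (f : ℕ → R) (k j : ℕ) :
    ∑ i ∈ Finset.range (2 ^ (k + j)), f (i % 2 ^ k) =
      2 ^ j * ∑ i ∈ Finset.range (2 ^ k), f (i % 2 ^ k) := by
  induction j with
  | zero => simp
  | succ j ih =>
    have hmod (i : ℕ) : (i + 2 ^ (k + j)) % 2 ^ k = i % 2 ^ k := by
      rw [pow_add, Nat.add_mul_mod_self_left]
    rw [← add_assoc, sum_range_two_pow_succ]
    simp only [hmod, ← two_mul, ← Finset.mul_sum, ih]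
    ring

section Collatz

variable {α β : ℕ} {C : ℕ → ℕ} {a b : ℕ → ℕ → ℕ}

theorem iterate_add_two_pow_mul
    (hab : ∀ k n : ℕ, 2 ^ k * C^[k] n = a (n % 2 ^ k) k * n + b (n % 2 ^ k) k) (k n t : ℕ) :
    C^[k] (n + 2 ^ k * t) = C^[k] n + a (n % 2 ^ k) k * t := by
  have h := hab k (n + 2 ^ k * t)
  rw [Nat.add_mul_mod_self_left] at h
  refine Nat.eq_of_mul_eq_mul_left (pow_pos two_pos k) ?_
  rw [h, mul_add (2 ^ k), hab k n]
  ring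

theorem collatz_leading_coeff_zero
    (hab : ∀ k n : ℕ, 2 ^ k * C^[k] n = a (n % 2 ^ k) k * n + b (n % 2 ^ k) k) (n : ℕ) :
    a (n % 2 ^ 0) 0 = 1 := by
  have h := iterate_add_two_pow_mul hab 0 n 1
  simp only [Function.iterate_zero, id_eq, pow_zero, mul_one] at h ⊢
  omega

theorem collatz_leading_coeff_succ
    (hC : ∀ n : ℕ, C n = if n % 2 = 0 then n / 2 else (α * n + β) / 2)
    (hab : ∀ k n : ℕ, 2 ^ k * C^[k] n = a (n % 2 ^ k) k * n + b (n % 2 ^ k) k) (k n : ℕ) :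
    a (n % 2 ^ (k + 1)) (k + 1) =
      (if C^[k] n % 2 = 0 then 1 else α) * a (n % 2 ^ k) k := by
  have hsucc := iterate_add_two_pow_mul hab (k + 1) n 1
  have hk := iterate_add_two_pow_mul hab k n 2
  rw [mul_one, mul_one, Function.iterate_succ_apply', Function.iterate_succ_apply', pow_succ, hk,
    hC, hC, Nat.add_mul_mod_self_right] at hsucc
  rw [pow_succ]
  split_ifs at hsucc ⊢ with hpar
  · omega
  · rw [mul_add, ← mul_assoc] at hsucc
    omega

theorem collatz_free_coeff_succ (hα : Odd α) (hβ : Odd β)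
    (hC : ∀ n : ℕ, C n = if n % 2 = 0 then n / 2 else (α * n + β) / 2)
    (hab : ∀ k n : ℕ, 2 ^ k * C^[k] n = a (n % 2 ^ k) k * n + b (n % 2 ^ k) k) (k n : ℕ) :
    b (n % 2 ^ (k + 1)) (k + 1) =
      if C^[k] n % 2 = 0 then b (n % 2 ^ k) k else α * b (n % 2 ^ k) k + 2 ^ k * β := by
  have hsucc := hab (k + 1) n
  have hk := hab k n
  rw [collatz_leading_coeff_succ hC hab, Function.iterate_succ_apply', hC, pow_succ (2 : ℕ) k,
    mul_assoc] at hsucc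
  rw [pow_succ]
  split_ifs at hsucc ⊢ with hpar
  · rw [Nat.mul_div_cancel' (Nat.dvd_of_mod_eq_zero hpar), one_mul, hk] at hsucc
    omega
  · have heven : 2 ∣ α * C^[k] n + β :=
      ((hα.mul (Nat.odd_iff.2 (by omega))).add_odd hβ).two_dvd
    rw [Nat.mul_div_cancel' heven] at hsucc
    zify at hsucc hk ⊢
    linear_combination (α : ℤ) * hk - hsucc

theorem odd_collatz_leading_coeff (hα : Odd α)
    (hC : ∀ n : ℕ, C n = if n % 2 = 0 then n / 2 else (α * n + β) / 2)
    (hab : ∀ k n : ℕ, 2 ^ k * C^[k] n = a (n % 2 ^ k) k * n + b (n % 2 ^ k) k) (k n : ℕ) :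
    Odd (a (n % 2 ^ k) k) := by
  induction k with
  | zero => rw [collatz_leading_coeff_zero hab]; exact odd_one
  | succ k ih =>
    rw [collatz_leading_coeff_succ hC hab]
    split_ifs
    · rwa [one_mul]
    · exact hα.mul ih

theorem iterate_add_two_pow_mod_two (hα : Odd α)
    (hC : ∀ n : ℕ, C n = if n % 2 = 0 then n / 2 else (α * n + β) / 2)
    (hab : ∀ k n : ℕ, 2 ^ k * C^[k] n = a (n % 2 ^ k) k * n + b (n % 2 ^ k) k) (k n : ℕ) :
    C^[k] (n + 2 ^ k) % 2 = 0 ↔ ¬ C^[k] n % 2 = 0 := by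
  have h := iterate_add_two_pow_mul hab k n 1
  have hodd := Nat.odd_iff.1 (odd_collatz_leading_coeff hα hC hab k n)
  rw [mul_one, mul_one] at h
  omega

theorem sum_collatz_leading_coeff (hα : Odd α)
    (hC : ∀ n : ℕ, C n = if n % 2 = 0 then n / 2 else (α * n + β) / 2)
    (hab : ∀ k n : ℕ, 2 ^ k * C^[k] n = a (n % 2 ^ k) k * n + b (n % 2 ^ k) k) (k : ℕ) :
    ∑ i ∈ Finset.range (2 ^ k), (a (i % 2 ^ k) k : ℤ) = ((α : ℤ) + 1) ^ k := by
  induction k with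
  | zero => simpa using collatz_leading_coeff_zero hab 0
  | succ k ih =>
    rw [sum_range_two_pow_succ, pow_succ ((α : ℤ) + 1), ← ih, Finset.sum_mul]
    refine Finset.sum_congr rfl fun i _ => ?_
    rw [collatz_leading_coeff_succ hC hab, collatz_leading_coeff_succ hC hab,
      Nat.add_mod_right]
    simp only [iterate_add_two_pow_mod_two hα hC hab]
    split_ifs <;> push_cast <;> ring

theorem sum_collatz_free_coeff_succ (hα : Odd α) (hβ : Odd β)
    (hC : ∀ n : ℕ, C n = if n % 2 = 0 then n / 2 else (α * n + β) / 2)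
    (hab : ∀ k n : ℕ, 2 ^ k * C^[k] n = a (n % 2 ^ k) k * n + b (n % 2 ^ k) k) (k : ℕ) :
    ∑ i ∈ Finset.range (2 ^ (k + 1)), (b (i % 2 ^ (k + 1)) (k + 1) : ℤ) =
      ((α : ℤ) + 1) * ∑ i ∈ Finset.range (2 ^ k), (b (i % 2 ^ k) k : ℤ) + β * 4 ^ k := by
  have hstep (i : ℕ) : (b (i % 2 ^ (k + 1)) (k + 1) : ℤ) +
      b ((i + 2 ^ k) % 2 ^ (k + 1)) (k + 1) =
        ((α : ℤ) + 1) * b (i % 2 ^ k) k + 2 ^ k * β := by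
    rw [collatz_free_coeff_succ hα hβ hC hab, collatz_free_coeff_succ hα hβ hC hab,
      Nat.add_mod_right]
    simp only [iterate_add_two_pow_mod_two hα hC hab]
    split_ifs <;> push_cast <;> ring
  rw [sum_range_two_pow_succ, Finset.sum_congr rfl fun i _ => hstep i, Finset.sum_add_distrib,
    ← Finset.mul_sum, Finset.sum_const, Finset.card_range, nsmul_eq_mul,
    show (4 : ℤ) = 2 * 2 by norm_num, mul_pow]
  push_cast
  ring

theorem sum_collatz_free_coeff_succ_sub (hα : Odd α) (hβ : Odd β)
    (hC : ∀ n : ℕ, C n = if n % 2 = 0 then n / 2 else (α * n + β) / 2)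
    (hab : ∀ k n : ℕ, 2 ^ k * C^[k] n = a (n % 2 ^ k) k * n + b (n % 2 ^ k) k) (k : ℕ) :
    ∑ i ∈ Finset.range (2 ^ (k + 1)), (b (i % 2 ^ (k + 1)) (k + 1) : ℤ) -
      4 * ∑ i ∈ Finset.range (2 ^ k), (b (i % 2 ^ k) k : ℤ) = β * ((α : ℤ) + 1) ^ k := by
  induction k with
  | zero =>
    have hb : b 0 0 = 0 := by simpa using (hab 0 0).symm
    rw [sum_collatz_free_coeff_succ hα hβ hC hab]
    simp [hb]
  | succ k ih =>
    have h := sum_collatz_free_coeff_succ hα hβ hC hab k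
    rw [sum_collatz_free_coeff_succ hα hβ hC hab (k + 1)]
    linear_combination ((α : ℤ) + 1) * ih - 4 * h

end Collatz

theorem sum_choose_mul_neg_four_pow (x : ℤ) (m : ℕ) :
    ∑ j ∈ Finset.range (m + 1), (m.choose j : ℤ) * (-4) ^ j * (x + 1) ^ (m - j) =
      (x - 3) ^ m := by
  rw [show x - 3 = -4 + (x + 1) by ring, add_pow]
  exact Finset.sum_congr rfl fun j _ => by ring

theorem sum_sum_choose_mul_mod (f : ℕ → ℕ → ℕ) (m : ℕ) :
    ∑ i ∈ Finset.range (2 ^ m), ∑ j ∈ Finset.range (m + 1),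
        (m.choose j : ℤ) * (-2) ^ j * (f (i % 2 ^ (m - j)) (m - j) : ℤ) =
      ∑ j ∈ Finset.range (m + 1), (m.choose j : ℤ) * (-4) ^ j *
        ∑ i ∈ Finset.range (2 ^ (m - j)), (f (i % 2 ^ (m - j)) (m - j) : ℤ) := by
  rw [Finset.sum_comm]
  refine Finset.sum_congr rfl fun j hj => ?_
  have hm : m - j + j = m := Nat.sub_add_cancel (Finset.mem_range_succ_iff.1 hj)
  have h := sum_range_two_pow_mod (fun i => (f i (m - j) : ℤ)) (m - j) j
  rw [hm] at h
  rw [← Finset.mul_sum, h, show (-4 : ℤ) = -2 * 2 by norm_num, mul_pow]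
  ring


/-- sums of the coefficients of the m-th discrete time derivative
of the Collatz orbit over all residue classes modulo 2^m. -/
theorem collatz_discrete_derivative_coefficient_sums
    (α β : ℕ) (hα : Odd α) (hα0 : 0 < α) (hβ : Odd β) (hβ0 : 0 < β)
    (hgcd : Nat.gcd α β = 1) (C : ℕ → ℕ)
    (hC : ∀ n : ℕ, C n = if n % 2 = 0 then n / 2 else (α * n + β) / 2)
    (a b : ℕ → ℕ → ℕ)
    (hab : ∀ k n : ℕ, 2 ^ k * C^[k] n = a (n % 2 ^ k) k * n + b (n % 2 ^ k) k)
    (m : ℕ) (hm : 1 ≤ m) :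
    (∑ i ∈ Finset.range (2 ^ m), ∑ j ∈ Finset.range (m + 1),
        (m.choose j : ℤ) * (-2) ^ j * (a (i % 2 ^ (m - j)) (m - j) : ℤ)
      = ((α : ℤ) - 3) ^ m) ∧
    (∑ i ∈ Finset.range (2 ^ m), ∑ j ∈ Finset.range (m + 1),
        (m.choose j : ℤ) * (-2) ^ j * (b (i % 2 ^ (m - j)) (m - j) : ℤ)
      = (β : ℤ) * ((α : ℤ) - 3) ^ (m - 1)) := by
  rw [sum_sum_choose_mul_mod, sum_sum_choose_mul_mod]
  constructor
  · simp only [sum_collatz_leading_coeff hα hC hab]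
    exact sum_choose_mul_neg_four_pow α m
  · obtain ⟨m, rfl⟩ := Nat.exists_eq_add_of_le' hm
    rw [sum_choose_succ_mul_shift 4
      (fun k => ∑ i ∈ Finset.range (2 ^ k), (b (i % 2 ^ k) k : ℤ)) m]
    simp only [sum_collatz_free_coeff_succ_sub hα hβ hC hab]
    rw [Nat.add_sub_cancel, ← sum_choose_mul_neg_four_pow, Finset.mul_sum]
    exact Finset.sum_congr rfl fun j _ => by ring
end

section
/- If λ ∈ ℂ and u ∈ H with u ≠ 0 satisfy 𝐂u = λ·u, then |λ| = 1. -/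
/-- A real number whose powers, scaled by a positive constant, stay bounded is at most one. -/
theorem le_one_of_pow_mul_bounded {r c M : ℝ} (hc : 0 < c) (h : ∀ k : ℕ, r ^ k * c ≤ M) :
    r ≤ 1 := by
  by_contra! hr
  obtain ⟨k, hk⟩ := pow_unbounded_of_one_lt (M / c) hr
  exact absurd (h k) (not_le.mpr ((div_lt_iff₀ hc).mp hk))


/-- any eigenvalue of the Collatz operator on ℓ² has modulus 1. -/
theorem collatz_operator_eigenvalue_modulus_one
    (α β : ℕ) (hα : Odd α) (hα0 : 0 < α) (hβ : Odd β) (hβ0 : 0 < β)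
    (hgcd : Nat.gcd α β = 1) (C : ℕ → ℕ)
    (hC : ∀ n : ℕ, C n = if n % 2 = 0 then n / 2 else (α * n + β) / 2)
    (T : lp (fun _ : ℕ => ℂ) 2 →L[ℂ] lp (fun _ : ℕ => ℂ) 2)
    (hT : ∀ (u : lp (fun _ : ℕ => ℂ) 2) (n : ℕ), T u n = u (C n))
    (lam : ℂ) (u : lp (fun _ : ℕ => ℂ) 2) (hu : u ≠ 0) (heig : T u = lam • u) :
    ‖lam‖ = 1 := by
  have hstep : ∀ n, u (C n) = lam * u n := fun n => by
    rw [← hT, heig]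
    rfl
  have hdouble : ∀ n, u n = lam * u (2 * n) := fun n => by
    have hCn : C (2 * n) = n := by
      rw [hC, if_pos (by omega)]
      omega
    simpa [hCn] using hstep (2 * n)
  obtain ⟨n, hn⟩ : ∃ n, u n ≠ 0 := by
    by_contra! h
    exact hu (lp.ext (funext h))
  have hbound : ∀ m, ‖u m‖ ≤ ‖u‖ := lp.norm_apply_le_norm two_ne_zero u
  have hlam : lam ≠ 0 := by
    rintro rfl
    exact hn (by simpa using hdouble n)
  have hforward : ∀ k : ℕ, u (C^[k] n) = lam ^ k * u n := fun k => by
    induction k with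
    | zero => simp
    | succ k ih => rw [Function.iterate_succ_apply', hstep, ih, pow_succ', mul_assoc]
  have hbackward : ∀ k : ℕ, u (2 ^ k * n) = lam⁻¹ ^ k * u n := fun k => by
    induction k with
    | zero => simp
    | succ k ih =>
      have h := hdouble (2 ^ k * n)
      rw [← mul_assoc, ← pow_succ', ih] at h
      rw [pow_succ' lam⁻¹, mul_assoc, h, inv_mul_cancel_left₀ hlam]
  have hle : ‖lam‖ ≤ 1 :=
    le_one_of_pow_mul_bounded (norm_pos_iff.mpr hn) fun k => by
      simpa [hforward] using hbound (C^[k] n)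
  have hge : ‖lam⁻¹‖ ≤ 1 :=
    le_one_of_pow_mul_bounded (norm_pos_iff.mpr hn) fun k => by
      simpa [hbackward] using hbound (2 ^ k * n)
  rw [norm_inv] at hge
  exact le_antisymm hle ((inv_le_one₀ (norm_pos_iff.mpr hlam)).mp hge)
end

section
/- The vectors e_n − e_{αn+β}, for n ranging over the odd positive integers, are pairwise orthogonal in H, they all lie in the kernel of the adjoint 𝐂*, and the kernel of 𝐂* equals the topological closure of their linear span (in particular ker 𝐂* is infinite dimensional). -/
open scoped InnerProductSpace

/-- The vector `e_n - e_{αn+β}` of `ℓ²(ℕ)`. -/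
noncomputable def collatzDiff (α β n : ℕ) : lp (fun _ : ℕ => ℂ) 2 :=
  lp.single 2 n 1 - lp.single 2 (α * n + β) 1

theorem inner_collatzDiff_left (α β n : ℕ) (v : lp (fun _ : ℕ => ℂ) 2) :
    ⟪collatzDiff α β n, v⟫_ℂ = v n - v (α * n + β) := by
  simp [collatzDiff, lp.inner_single_left]

theorem collatzDiff_apply (α β n k : ℕ) :
    collatzDiff α β n k = (if k = n then 1 else 0) - (if k = α * n + β then 1 else 0) := by
  simp [collatzDiff, Pi.single_apply]

theorem even_mul_add_of_odd {α β n : ℕ} (hα : Odd α) (hβ : Odd β) (hn : Odd n) :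
    Even (α * n + β) :=
  (hα.mul hn).add_odd hβ

theorem inner_collatzDiff_of_ne {α β n m : ℕ} (hα : Odd α) (hβ : Odd β) (hn : Odd n)
    (hm : Odd m) (hnm : n ≠ m) : ⟪collatzDiff α β n, collatzDiff α β m⟫_ℂ = 0 := by
  have hn' := even_mul_add_of_odd hα hβ hn
  have hm' := even_mul_add_of_odd hα hβ hm
  have h1 : n ≠ α * m + β := by rintro rfl; exact Nat.not_even_iff_odd.2 hn hm'
  have h2 : α * n + β ≠ m := by rintro rfl; exact Nat.not_even_iff_odd.2 hm hn'
  have h3 : α * n + β ≠ α * m + β := by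
    intro h
    exact hnm (Nat.eq_of_mul_eq_mul_left hα.pos (Nat.add_right_cancel h))
  rw [inner_collatzDiff_left, collatzDiff_apply, collatzDiff_apply]
  simp only [hnm, h1, h2, h3, if_false, sub_self]

theorem collatzDiff_ne_zero {α β n : ℕ} (hα : Odd α) (hβ : Odd β) (hn : Odd n) :
    collatzDiff α β n ≠ 0 := by
  intro h
  have h1 : n ≠ α * n + β := fun h1 =>
    Nat.not_even_iff_odd.2 hn (h1 ▸ even_mul_add_of_odd hα hβ hn)
  have h2 := collatzDiff_apply α β n n
  rw [h, if_pos rfl, if_neg h1] at h2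
  simp at h2

section Composition

variable {α β : ℕ} {C : ℕ → ℕ} {T : lp (fun _ : ℕ => ℂ) 2 →L[ℂ] lp (fun _ : ℕ => ℂ) 2}

theorem adjoint_collatzDiff (hα : Odd α) (hβ : Odd β)
    (hC : ∀ n : ℕ, C n = if n % 2 = 0 then n / 2 else (α * n + β) / 2)
    (hT : ∀ (u : lp (fun _ : ℕ => ℂ) 2) (n : ℕ), T u n = u (C n)) {n : ℕ} (hn : Odd n) :
    ContinuousLinearMap.adjoint T (collatzDiff α β n) = 0 := by
  refine ext_inner_right ℂ fun u => ?_
  have h : C n = C (α * n + β) := by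
    rw [hC, hC, if_neg (by have := Nat.odd_iff.1 hn; omega),
      if_pos (Nat.even_iff.1 (even_mul_add_of_odd hα hβ hn))]
  rw [ContinuousLinearMap.adjoint_inner_left, inner_collatzDiff_left, hT, hT, h, sub_self,
    inner_zero_left]

theorem eq_zero_of_adjoint_eq_zero_of_inner_collatzDiff (hα : Odd α) (hβ : Odd β)
    (hC : ∀ n : ℕ, C n = if n % 2 = 0 then n / 2 else (α * n + β) / 2)
    (hT : ∀ (u : lp (fun _ : ℕ => ℂ) 2) (n : ℕ), T u n = u (C n))
    {v : lp (fun _ : ℕ => ℂ) 2} (hv : ContinuousLinearMap.adjoint T v = 0)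
    (hd : ∀ n, Odd n → ⟪collatzDiff α β n, v⟫_ℂ = 0) : v = 0 := by
  have hodd : ∀ n, Odd n → v n = v (α * n + β) := fun n hn =>
    sub_eq_zero.1 (inner_collatzDiff_left α β n v ▸ hd n hn)
  have hrange : ∀ u, ⟪T u, v⟫_ℂ = 0 := fun u => by
    rw [← ContinuousLinearMap.adjoint_inner_right, hv, inner_zero_right]
  have hCeven : ∀ k, k % 2 = 0 → C k = k / 2 := fun k hk => by rw [hC, if_pos hk]
  have hCodd : ∀ k, k % 2 ≠ 0 → 2 * C k = α * k + β := fun k hk => by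
    rw [hC, if_neg hk]
    exact Nat.two_mul_div_two_of_even
      (even_mul_add_of_odd hα hβ (Nat.odd_iff.2 (by omega)))
  have heven : ∀ m, v (2 * m) = 0 := by
    intro m
    by_cases hm : ∃ n, Odd n ∧ α * n + β = 2 * m
    · obtain ⟨n, hn, hnm⟩ := hm
      have hTm : T (lp.single 2 m 1) = lp.single 2 (2 * m) 1 + lp.single 2 n 1 := by
        ext k
        have hn2 := Nat.odd_iff.1 hn
        rw [hT]
        simp only [lp.coeFn_add, Pi.add_apply, lp.coeFn_single, Pi.single_apply]
        by_cases hk : k % 2 = 0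
        · have h1 : k ≠ n := by omega
          have h2 : C k = m ↔ k = 2 * m := by rw [hCeven k hk]; omega
          simp [h1, h2]
        · have h1 : k ≠ 2 * m := by omega
          have h2 : C k = m ↔ k = n := by
            have h3 := hCodd k hk
            constructor
            · rintro rfl
              exact Nat.eq_of_mul_eq_mul_left hα.pos (by omega)
            · rintro rfl
              omega
          simp [h1, h2]
      have h := hrange (lp.single 2 m 1)
      rw [hTm, inner_add_left, lp.inner_single_left, lp.inner_single_left, hodd n hn, hnm] at h
      simpa using h
    · have hTm : T (lp.single 2 m 1) = lp.single 2 (2 * m) 1 := by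
        ext k
        rw [hT]
        simp only [lp.coeFn_single, Pi.single_apply]
        have h2 : C k = m ↔ k = 2 * m := by
          by_cases hk : k % 2 = 0
          · rw [hCeven k hk]; omega
          · have h3 := hCodd k hk
            constructor
            · rintro rfl
              exact absurd ⟨k, Nat.odd_iff.2 (by omega), h3.symm⟩ hm
            · omega
        simp [h2]
      have h := hrange (lp.single 2 m 1)
      rw [hTm, lp.inner_single_left] at h
      simpa using h
  ext k
  rcases Nat.even_or_odd k with hk | hk
  · rw [← Nat.two_mul_div_two_of_even hk, heven]
    rfl
  · rw [hodd k hk, ← Nat.two_mul_div_two_of_even (even_mul_add_of_odd hα hβ hk), heven]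
    rfl

theorem ker_adjoint_eq_closure_span_collatzDiff (hα : Odd α) (hβ : Odd β)
    (hC : ∀ n : ℕ, C n = if n % 2 = 0 then n / 2 else (α * n + β) / 2)
    (hT : ∀ (u : lp (fun _ : ℕ => ℂ) 2) (n : ℕ), T u n = u (C n)) :
    LinearMap.ker (ContinuousLinearMap.adjoint T).toLinearMap
      = (Submodule.span ℂ {v | ∃ n, Odd n ∧ v = collatzDiff α β n}).topologicalClosure := by
  set S := Submodule.span ℂ {v | ∃ n, Odd n ∧ v = collatzDiff α β n}
  have hle : S.topologicalClosure ≤ LinearMap.ker (ContinuousLinearMap.adjoint T).toLinearMap := by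
    refine Submodule.topologicalClosure_minimal _ (Submodule.span_le.2 ?_)
      (ContinuousLinearMap.adjoint T).isClosed_ker
    rintro _ ⟨n, hn, rfl⟩
    exact adjoint_collatzDiff hα hβ hC hT hn
  have : CompleteSpace S.topologicalClosure := S.isClosed_topologicalClosure.completeSpace_coe
  refine le_antisymm ?_ hle
  rw [← Submodule.sup_orthogonal_inf_of_hasOrthogonalProjection hle, sup_le_iff]
  refine ⟨le_rfl, fun v hv => ?_⟩
  rw [eq_zero_of_adjoint_eq_zero_of_inner_collatzDiff hα hβ hC hT hv.2 fun n hn => hv.1 _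
    (S.le_topologicalClosure (Submodule.subset_span ⟨n, hn, rfl⟩))]
  exact zero_mem _

theorem not_finiteDimensional_ker_adjoint (hα : Odd α) (hβ : Odd β)
    (hC : ∀ n : ℕ, C n = if n % 2 = 0 then n / 2 else (α * n + β) / 2)
    (hT : ∀ (u : lp (fun _ : ℕ => ℂ) 2) (n : ℕ), T u n = u (C n)) :
    ¬ FiniteDimensional ℂ (LinearMap.ker (ContinuousLinearMap.adjoint T).toLinearMap) := by
  intro hfin
  have hli : LinearIndependent ℂ fun k : ℕ => collatzDiff α β (2 * k + 1) :=
    linearIndependent_of_ne_zero_of_inner_eq_zero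
      (fun k => collatzDiff_ne_zero hα hβ (odd_two_mul_add_one k))
      fun i j hij => inner_collatzDiff_of_ne hα hβ (odd_two_mul_add_one i)
        (odd_two_mul_add_one j) (by omega)
  have hli' : LinearIndependent ℂ fun k : ℕ =>
      (⟨collatzDiff α β (2 * k + 1),
        adjoint_collatzDiff hα hβ hC hT (odd_two_mul_add_one k)⟩ :
        LinearMap.ker (ContinuousLinearMap.adjoint T).toLinearMap) :=
    LinearIndependent.of_comp (Submodule.subtype _) hli
  have := hli'.finite
  exact not_finite ℕ

end Composition

/-- the vectors e_n − e_{αn+β} (n odd) are pairwise orthogonal,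
lie in ker 𝐂*, and ker 𝐂* is the closure of their span; in particular ker 𝐂*
is infinite dimensional. -/
theorem collatz_adjoint_kernel_description
    (α β : ℕ) (hα : Odd α) (hα0 : 0 < α) (hβ : Odd β) (hβ0 : 0 < β)
    (hgcd : Nat.gcd α β = 1) (C : ℕ → ℕ)
    (hC : ∀ n : ℕ, C n = if n % 2 = 0 then n / 2 else (α * n + β) / 2)
    (T : lp (fun _ : ℕ => ℂ) 2 →L[ℂ] lp (fun _ : ℕ => ℂ) 2)
    (hT : ∀ (u : lp (fun _ : ℕ => ℂ) 2) (n : ℕ), T u n = u (C n)) :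
    (∀ n m : ℕ, Odd n → Odd m → n ≠ m →
      ⟪(lp.single 2 n 1 - lp.single 2 (α * n + β) 1 : lp (fun _ : ℕ => ℂ) 2),
        (lp.single 2 m 1 - lp.single 2 (α * m + β) 1 : lp (fun _ : ℕ => ℂ) 2)⟫_ℂ = 0) ∧
    (∀ n : ℕ, Odd n →
      ContinuousLinearMap.adjoint T
        (lp.single 2 n 1 - lp.single 2 (α * n + β) 1) = 0) ∧
    LinearMap.ker (ContinuousLinearMap.adjoint T).toLinearMap
      = (Submodule.span ℂ
          {v : lp (fun _ : ℕ => ℂ) 2 | ∃ n : ℕ, Odd n ∧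
            v = lp.single 2 n 1 - lp.single 2 (α * n + β) 1}).topologicalClosure ∧
    ¬ FiniteDimensional ℂ (LinearMap.ker (ContinuousLinearMap.adjoint T).toLinearMap) := by
  exact ⟨fun n m hn hm hnm => inner_collatzDiff_of_ne hα hβ hn hm hnm,
    fun n hn => adjoint_collatzDiff hα hβ hC hT hn,
    ker_adjoint_eq_closure_span_collatzDiff hα hβ hC hT,
    not_finiteDimensional_ker_adjoint hα hβ hC hT⟩
end

section
/- Let n₁ ∈ ℕ and m ≥ 1 satisfy C^m(n₁) = n₁ (a Collatz cycle of length m). Let u₀ ∈ H and let u : ℝ → H be a continuous function satisfying u(t) = u₀ + ∫₀ᵗ 𝐂(u(s)) ds for all t ≥ 0. Then there exist complex numbers c_0, …, c_{m−1} such that for every t ≥ 0, the coordinate of u(t) at index n₁ equals Σ_{j=0}^{m−1} c_j · exp(λ_j t), where λ_j = exp(2πi j/m) are the m-th roots of unity; in particular each λ_j satisfies |λ_j| = 1. -/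
open Set in
/-- A real-linear functional that intertwines `T` with multiplication by `μ` turns a solution of
the integral equation `u t = u₀ + ∫ s in 0..t, T (u s)` into a multiple of `exp (μ t)`. -/
theorem eigenfunctional_apply_eq_exp {E : Type*} [NormedAddCommGroup E] [NormedSpace ℝ E]
    [CompleteSpace E] (T : E → E) (hT : Continuous T) (φ : E →L[ℝ] ℂ) (μ : ℂ)
    (hφ : ∀ w, φ (T w) = μ * φ w) (u₀ : E) (u : ℝ → E) (hu : Continuous u)
    (huint : ∀ t : ℝ, 0 ≤ t → u t = u₀ + ∫ s in (0 : ℝ)..t, T (u s)) (t : ℝ) (ht : 0 ≤ t) :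
    φ (u t) = φ (u 0) * Complex.exp (μ * t) := by
  have hφu (x : ℝ) (hx : 0 ≤ x) :
      HasDerivWithinAt (fun s => φ (u s)) (μ * φ (u x)) (Ici x) x := by
    have h := ((hT.comp hu).integral_hasStrictDerivAt 0 x).hasDerivAt.const_add u₀
    have h' := (φ.hasFDerivAt.comp_hasDerivAt x h).hasDerivWithinAt (s := Ici x)
    rw [← hφ]
    exact h'.congr (fun y hy => congrArg φ (huint y (hx.trans hy))) (congrArg φ (huint x hx))
  have hexp (x : ℝ) : HasDerivAt (fun s : ℝ => Complex.exp (-(μ * s)))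
      (Complex.exp (-(μ * x)) * -(μ * 1)) x :=
    (((Complex.ofRealCLM.hasDerivAt (x := x)).const_mul μ).neg).cexp
  have hconst := constant_of_has_deriv_right_zero (a := 0) (b := t)
    (f := fun s : ℝ => φ (u s) * Complex.exp (-(μ * s)))
    (Continuous.continuousOn (by fun_prop))
    (fun x hx => ((hφu x hx.1).mul (hexp x).hasDerivWithinAt).congr_deriv (by ring))
    t ⟨ht, le_rfl⟩
  simp only [Complex.ofReal_zero, mul_zero, neg_zero, Complex.exp_zero, mul_one] at hconst
  rw [← hconst, mul_assoc, ← Complex.exp_add, neg_add_cancel, Complex.exp_zero, mul_one]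

/-- Shifting an `m`-periodic sequence multiplies its discrete Fourier coefficients by the
corresponding `m`-th root of unity. -/
theorem sum_inv_pow_mul_shift {m : ℕ} {μ : ℂ} (hμ : μ ^ m = 1) (hμ0 : μ ≠ 0)
    (x : ℕ → ℂ) (hx : x m = x 0) :
    ∑ k ∈ Finset.range m, μ⁻¹ ^ k * x (k + 1) = μ * ∑ k ∈ Finset.range m, μ⁻¹ ^ k * x k := by
  have h := (Finset.sum_range_succ' (fun k => μ⁻¹ ^ k * x k) m).symm.trans
    (Finset.sum_range_succ (fun k => μ⁻¹ ^ k * x k) m)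
  simp only [inv_pow, hμ, hx, inv_one, pow_zero, add_left_inj] at h
  simp only [inv_pow]
  rw [← h, Finset.mul_sum]
  refine Finset.sum_congr rfl fun k _ => ?_
  field_simp
  ring

/-- Fourier inversion at `0` for sequences of length `m`. -/
theorem sum_sum_inv_pow_mul {m : ℕ} (hm : 1 ≤ m) {ω : ℂ} (hω : IsPrimitiveRoot ω m)
    (x : ℕ → ℂ) :
    ∑ j : Fin m, ∑ k ∈ Finset.range m, (ω ^ (j : ℕ))⁻¹ ^ k * x k = m * x 0 := by
  rw [Finset.sum_comm, Finset.sum_eq_single_of_mem 0 (Finset.mem_range.2 hm)]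
  · simp
  · intro k hk hk0
    have hne : ω⁻¹ ^ k ≠ 1 := hω.inv.pow_ne_one_of_pos_of_lt hk0 (Finset.mem_range.1 hk)
    have hgeom : ∑ j ∈ Finset.range m, (ω⁻¹ ^ k) ^ j = 0 := by
      rw [geom_sum_eq hne, ← pow_mul, mul_comm, pow_mul, hω.inv.pow_eq_one, one_pow, sub_self,
        zero_div]
    rw [← Finset.sum_mul, Fin.sum_univ_eq_sum_range (fun j => (ω ^ j)⁻¹ ^ k) m]
    simp_rw [← inv_pow, ← pow_mul, mul_comm _ k, pow_mul]
    rw [hgeom, zero_mul]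


/-- if n₁ lies on a Collatz cycle of length m, the coordinate of a
solution of the Collatz flow at index n₁ is a combination of exponentials
exp(λ_j t) where λ_j = exp(2πi j/m) are the m-th roots of unity, all of
modulus 1. -/
theorem collatz_flow_cycle_coordinate_exponentials
    (α β : ℕ) (hα : Odd α) (hα0 : 0 < α) (hβ : Odd β) (hβ0 : 0 < β)
    (hgcd : Nat.gcd α β = 1) (C : ℕ → ℕ)
    (hC : ∀ n : ℕ, C n = if n % 2 = 0 then n / 2 else (α * n + β) / 2)
    (CZ : ℤ → ℤ) (hCZ : ∀ n : ℕ, CZ n = C n) (hCZodd : ∀ n : ℤ, CZ (-n) = -CZ n)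
    (T : lp (fun _ : ℤ => ℂ) 2 →L[ℂ] lp (fun _ : ℤ => ℂ) 2)
    (hT : ∀ (u : lp (fun _ : ℤ => ℂ) 2) (n : ℤ), T u n = u (CZ n))
    (n₁ m : ℕ) (hm : 1 ≤ m) (hcycle : C^[m] n₁ = n₁)
    (u₀ : lp (fun _ : ℤ => ℂ) 2) (u : ℝ → lp (fun _ : ℤ => ℂ) 2)
    (hu : Continuous u)
    (huint : ∀ t : ℝ, 0 ≤ t → u t = u₀ + ∫ s in (0:ℝ)..t, T (u s)) :
    ∃ c : Fin m → ℂ,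
      (∀ t : ℝ, 0 ≤ t →
        u t (n₁ : ℤ) = ∑ j : Fin m, c j *
          Complex.exp (Complex.exp (2 * Real.pi * Complex.I * (j : ℕ) / m) * t)) ∧
      ∀ j : Fin m,
        ‖Complex.exp (2 * Real.pi * Complex.I * (j : ℕ) / m)‖ = 1 := by
  have hm0 : m ≠ 0 := Nat.one_le_iff_ne_zero.1 hm
  have hω := Complex.isPrimitiveRoot_exp m hm0
  set ω : ℂ := Complex.exp (2 * Real.pi * Complex.I / m) with hω_def
  have hroot (j : ℕ) : Complex.exp (2 * Real.pi * Complex.I * j / m) = ω ^ j := by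
    rw [hω_def, ← Complex.exp_nat_mul]
    congr 1
    ring
  have hpow (j : ℕ) : (ω ^ j) ^ m = 1 := by rw [pow_right_comm, hω.pow_eq_one, one_pow]
  simp only [hroot]
  let φ (μ : ℂ) : lp (fun _ : ℤ => ℂ) 2 →L[ℝ] ℂ :=
    (∑ k ∈ Finset.range m,
      μ⁻¹ ^ k • lp.evalCLM ℂ (fun _ : ℤ => ℂ) 2 ((C^[k] n₁ : ℕ) : ℤ)).restrictScalars ℝ
  have hφ_apply (μ : ℂ) (w : lp (fun _ : ℤ => ℂ) 2) :
      φ μ w = ∑ k ∈ Finset.range m, μ⁻¹ ^ k * w ((C^[k] n₁ : ℕ) : ℤ) := by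
    simp [φ, lp.evalCLM]
  have hφT (j : ℕ) (w : lp (fun _ : ℤ => ℂ) 2) : φ (ω ^ j) (T w) = ω ^ j * φ (ω ^ j) w := by
    simp only [hφ_apply, hT, hCZ, ← Function.iterate_succ_apply' C]
    exact sum_inv_pow_mul_shift (hpow j) (pow_ne_zero j (Complex.exp_ne_zero _))
      (fun k => w ((C^[k] n₁ : ℕ) : ℤ)) (by simp [hcycle])
  refine ⟨fun j => (m : ℂ)⁻¹ * φ (ω ^ (j : ℕ)) (u 0), fun t ht => ?_,
    fun j => Complex.norm_eq_one_of_pow_eq_one (hpow j) hm0⟩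
  have hinv := sum_sum_inv_pow_mul hm hω fun k => u t ((C^[k] n₁ : ℕ) : ℤ)
  simp only [← hφ_apply, Function.iterate_zero, id] at hinv
  simp_rw [mul_assoc, ← eigenfunctional_apply_eq_exp T T.continuous (φ _) _ (hφT _) u₀ u hu huint
    t ht]
  rw [← Finset.mul_sum, hinv, inv_mul_cancel_left₀ (Nat.cast_ne_zero.2 hm0)]
end
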